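/- arXiv:1608.00741 — 2 statements merged into one kernel-verified Lean document; each statement's English description precedes it below -/
import Mathlib

section
/- Let n be an even natural number and let M1 and M2 be n×n matrices with real entries, with M1ℂ and M2ℂ the same matrices viewed over the complex numbers. Then det(fromBlocks M1 M2 M2 (−M1)) = normSq(det(M1ℂ + i·M2ℂ)); in particular this determinant is nonnegative and its absolute value equals |det(M1ℂ + i·M2ℂ)|². -/
open Matrix Complex

/-- Over a commutative ring containing a square root `i` of `-1`, the determinant of
    [[A, B], [B, −A]] factors as det(A + i·B) · det(−(A − i·B)). -/
theorem Matrix.det_fromBlocks_neg_of_sq_eq_neg_one {m R : Type*} [Fintype m] [DecidableEq m]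
    [CommRing R] {i : R} (hi : i * i = -1) (A B : Matrix m m R) :
    (fromBlocks A B B (-A)).det = (A + i • B).det * (-(A - i • B)).det := by
  have key : fromBlocks 1 (i • 1) 0 1 * fromBlocks A B B (-A) * fromBlocks 1 (i • 1) 0 1 =
      fromBlocks (A + i • B) 0 B (-(A - i • B)) := by
    simp only [fromBlocks_multiply]
    congr 1
    · simp
    · simp [smul_smul, hi]
    · simp
    · simp [sub_eq_add_neg, add_comm]
  simpa using congrArg det key

/-- For an even n and real n×n matrices M1, M2, the determinant of the block
    matrix [[M1, M2], [M2, −M1]] equals |det(M1ℂ + i·M2ℂ)|². -/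
theorem det_fromBlocks_eq_normSq_of_even {n : ℕ} (hn : Even n)
    (M1 M2 : Matrix (Fin n) (Fin n) ℝ) :
    (Matrix.fromBlocks M1 M2 M2 (-M1)).det =
      Complex.normSq ((M1.map (Complex.ofReal) +
        Complex.I • M2.map (Complex.ofReal)).det) := by
  have hconj : (M1.map Complex.ofReal - Complex.I • M2.map Complex.ofReal).det =
      starRingEnd ℂ (M1.map Complex.ofReal + Complex.I • M2.map Complex.ofReal).det := by
    rw [RingHom.map_det]
    congr 1
    ext j k
    simp [sub_eq_add_neg]
  have hmap : Complex.ofRealHom.mapMatrix (fromBlocks M1 M2 M2 (-M1)) =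
      fromBlocks (M1.map Complex.ofReal) (M2.map Complex.ofReal)
        (M2.map Complex.ofReal) (-M1.map Complex.ofReal) := by
    ext (j | j) (k | k) <;> simp
  apply Complex.ofReal_injective
  change Complex.ofRealHom _ = _
  rw [RingHom.map_det, hmap, det_fromBlocks_neg_of_sq_eq_neg_one Complex.I_mul_I, det_neg,
    Fintype.card_fin, hn.neg_one_pow, one_mul, hconj, Complex.mul_conj]
end

section
/- Let H be a finite-dimensional vector space over ZMod 2 and let B : H → H → ZMod 2 be a symmetric bilinear form. Then there exists a quadratic enhancement relative to B, i.e. a function q : H → ZMod 4 satisfying q(α+β) = q(α) + q(β) + e(B(α,β)) for all α, β ∈ H. -/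
/-- The doubling map `ZMod 2 → ZMod 4`, sending 0 ↦ 0 and 1 ↦ 2. -/
def dblMap : ZMod 2 → ZMod 4 := fun x => 2 * (x.val : ZMod 4)

theorem dblMap_add (a b : ZMod 2) : dblMap (a + b) = dblMap a + dblMap b := by
  revert a b; decide

theorem dblMap_sum {ι : Type*} (s : Finset ι) (f : ι → ZMod 2) :
    dblMap (∑ i ∈ s, f i) = ∑ i ∈ s, dblMap (f i) :=
  map_sum (AddMonoidHom.mk' dblMap dblMap_add) f s

theorem dblMap_mul_mul (a b c : ZMod 2) :
    dblMap (a * (b * c)) = 2 * ((a.val : ZMod 4) * (c.val : ZMod 4) * (b.val : ZMod 4)) := by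
  revert a b c; decide

theorem natCast_val_add (a b : ZMod 2) :
    ((a + b).val : ZMod 4) = a.val + b.val + 2 * (a.val * b.val) := by
  revert a b; decide

/-- Over `ZMod 4`, the diagonal of a symmetric bilinear form is unchanged by adding twice a
vector to its argument. -/
theorem apply_self_add_add_two_smul {V : Type*} [AddCommGroup V] [Module (ZMod 4) V]
    (S : V →ₗ[ZMod 4] V →ₗ[ZMod 4] ZMod 4) (hS : ∀ v w, S v w = S w v) (x y c : V) :
    S (x + y + (2 : ZMod 4) • c) (x + y + (2 : ZMod 4) • c) = S x x + S y y + 2 * S x y := by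
  have h4 : (4 : ZMod 4) = 0 := by decide
  simp only [map_add, map_smul, LinearMap.add_apply, LinearMap.smul_apply, smul_eq_mul]
  rw [hS y x, hS c x, hS c y]
  linear_combination (S x c + S y c + S c c) * h4

/-- Every symmetric bilinear form on a finite-dimensional `ZMod 2`-vector
    space admits a quadratic enhancement. -/
theorem exists_quadratic_enhancement {H : Type*} [AddCommGroup H]
    [Module (ZMod 2) H] [FiniteDimensional (ZMod 2) H]
    (B : H →ₗ[ZMod 2] H →ₗ[ZMod 2] ZMod 2)
    (hB : ∀ α β : H, B α β = B β α) :
    ∃ q : H → ZMod 4, ∀ α β : H, q (α + β) = q α + q β + dblMap (B α β) := by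
  let b := Module.finBasis (ZMod 2) H
  let M : Matrix (Fin (Module.finrank (ZMod 2) H)) (Fin (Module.finrank (ZMod 2) H)) (ZMod 4) :=
    Matrix.of fun i j => ((B (b i) (b j)).val : ZMod 4)
  let S : (Fin (Module.finrank (ZMod 2) H) → ZMod 4) →ₗ[ZMod 4]
      (Fin (Module.finrank (ZMod 2) H) → ZMod 4) →ₗ[ZMod 4] ZMod 4 :=
    Matrix.toLinearMap₂' (ZMod 4) M
  let l : H → Fin (Module.finrank (ZMod 2) H) → ZMod 4 := fun x i => ((b.repr x i).val : ZMod 4)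
  have happly : ∀ v w, S v w = ∑ i, ∑ j, v i * w j * M i j := fun v w => by
    simp [S, Matrix.toLinearMap₂'_apply, mul_assoc]
  have hS : ∀ v w, S v w = S w v := fun v w => by
    rw [happly, happly, Finset.sum_comm]
    refine Finset.sum_congr rfl fun i _ => Finset.sum_congr rfl fun j _ => ?_
    simp only [M, Matrix.of_apply, hB (b j) (b i)]
    ring
  have hl : ∀ x y, l (x + y) = l x + l y + (2 : ZMod 4) • (l x * l y) := fun x y => by
    ext i
    simpa [l] using natCast_val_add (b.repr x i) (b.repr y i)
  have hdbl : ∀ x y, dblMap (B x y) = 2 * S (l x) (l y) := fun x y => by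
    have hxy : B x y = ∑ i, ∑ j, b.repr x i * (B (b i) (b j) * b.repr y j) := by
      conv_lhs => rw [← b.sum_repr x, ← b.sum_repr y]
      simp only [map_sum, map_smul, LinearMap.sum_apply, LinearMap.smul_apply, smul_eq_mul,
        Finset.mul_sum]
      rw [Finset.sum_comm]
      refine Finset.sum_congr rfl fun i _ => Finset.sum_congr rfl fun j _ => ?_
      ring
    simp_rw [hxy, dblMap_sum, dblMap_mul_mul, happly, Finset.mul_sum]
    rfl
  refine ⟨fun x => S (l x) (l x), fun x y => ?_⟩
  simp only [hl x y, hdbl]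
  exact apply_self_add_add_two_smul S hS _ _ _
end
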